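/- arXiv:2411.02942 — 2 statements merged into one kernel-verified Lean document; each statement's English description precedes it below -/
import Mathlib

section
/- Let f : [0,1]^n → ℝ be a function such that (i) for every coordinate a, the map s ↦ f(x + s·e_a) is concave on its domain for every x, and (ii) for every pair of distinct coordinates a, b, the map s ↦ f(x + s·(e_a − e_b)) is concave on its domain for every x. Let x* ∈ [0,1]^n and let p be a finitely supported probability distribution on [0,1]^n obtained from the point mass at x* by a finite sequence of pipage steps. Then E_{x ∼ p}[f(x)] ≤ f(x*). -/
/-- The standard basis vector `e_a` of `ℝ^n`. -/
def ea (n : ℕ) (a : Fin n) : Fin n → ℝ := fun j => if j = a then 1 else 0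

/-- The direction `e_a - e_b`. -/
def dir (n : ℕ) (a b : Fin n) : Fin n → ℝ := fun j => ea n a j - ea n b j

/-- `ν` is an admissible replacement distribution for the point `x` in a pipage step:
either the point mass at `x`, or a two-point distribution given by Operation 1 or
Operation 2 of the modified pipage rounding procedure. -/
def IsPipageNu (n : ℕ) (x : Fin n → ℝ) (ν : (Fin n → ℝ) →₀ ℝ) : Prop :=
  ν = Finsupp.single x 1 ∨
  (∃ a : Fin n, ∃ δ₁ δ₂ : ℝ, 0 < x a ∧ x a < 1 ∧
    0 < δ₁ ∧ δ₁ ≤ x a ∧ 0 < δ₂ ∧ δ₂ ≤ 1 - x a ∧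
    ν = Finsupp.single (fun j => x j - δ₁ * ea n a j) (δ₂ / (δ₁ + δ₂)) +
        Finsupp.single (fun j => x j + δ₂ * ea n a j) (δ₁ / (δ₁ + δ₂))) ∨
  (∃ a b : Fin n, a ≠ b ∧ ∃ δ₁ δ₂ : ℝ,
    0 < x a ∧ x a < 1 ∧ 0 < x b ∧ x b < 1 ∧
    0 < δ₁ ∧ δ₁ ≤ min (x a) (1 - x b) ∧ 0 < δ₂ ∧ δ₂ ≤ min (1 - x a) (x b) ∧
    ν = Finsupp.single (fun j => x j - δ₁ * dir n a b j) (δ₂ / (δ₁ + δ₂)) +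
        Finsupp.single (fun j => x j + δ₂ * dir n a b j) (δ₁ / (δ₁ + δ₂)))

/-- A pipage step transforms the finitely supported distribution `p` into `p'` by
replacing each point `x` of its support with an admissible distribution `ν x`. -/
def PipageStep (n : ℕ) (p p' : (Fin n → ℝ) →₀ ℝ) : Prop :=
  ∃ ν : (Fin n → ℝ) → ((Fin n → ℝ) →₀ ℝ),
    (∀ x ∈ p.support, IsPipageNu n x (ν x)) ∧
    p' = p.sum (fun x w => w • ν x)

def PGood (n : ℕ) (f : (Fin n → ℝ) → ℝ) (c : ℝ) (p : (Fin n → ℝ) →₀ ℝ) : Prop :=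
  (∀ x, 0 ≤ p x) ∧ (∀ x, p x ≠ 0 → ∀ j, x j ∈ Set.Icc (0:ℝ) 1) ∧
    Finsupp.linearCombination ℝ f p ≤ c

lemma pgood_single (n : ℕ) (f : (Fin n → ℝ) → ℝ) (x : Fin n → ℝ)
    (hx : ∀ j, x j ∈ Set.Icc (0:ℝ) 1) : PGood n f (f x) (Finsupp.single x 1) := by
  classical
  refine ⟨fun y => ?_, fun y hy => ?_, ?_⟩
  · rw [Finsupp.single_apply]; split_ifs <;> norm_num
  · rw [Finsupp.single_apply] at hy
    split_ifs at hy with h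
    · exact h ▸ hx
    · exact absurd rfl hy
  · simp

lemma pgood_pair (n : ℕ) (f : (Fin n → ℝ) → ℝ) (x d : Fin n → ℝ) (s t : ℝ)
    (hs : 0 < s) (ht : 0 < t)
    (hc : ConcaveOn ℝ {s : ℝ | ∀ j, x j + s * d j ∈ Set.Icc (0:ℝ) 1}
        (fun s => f (fun j => x j + s * d j)))
    (h1 : ∀ j, x j - s * d j ∈ Set.Icc (0:ℝ) 1)
    (h2 : ∀ j, x j + t * d j ∈ Set.Icc (0:ℝ) 1) :
    PGood n f (f x) (Finsupp.single (fun j => x j - s * d j) (t / (s + t)) +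
        Finsupp.single (fun j => x j + t * d j) (s / (s + t))) := by
  classical
  have a1 : 0 ≤ t / (s + t) := by positivity
  have a2 : 0 ≤ s / (s + t) := by positivity
  refine ⟨fun y => ?_, fun y hy => ?_, ?_⟩
  · rw [Finsupp.add_apply, Finsupp.single_apply, Finsupp.single_apply]
    split_ifs <;> linarith
  · rw [Finsupp.add_apply, Finsupp.single_apply, Finsupp.single_apply] at hy
    split_ifs at hy with h h' h'
    · exact h ▸ h1
    · exact h ▸ h1
    · exact h' ▸ h2
    · simp at hy
  · have h1' : (-s) ∈ {s : ℝ | ∀ j, x j + s * d j ∈ Set.Icc (0:ℝ) 1} := by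
      intro j
      have := h1 j
      rwa [sub_eq_add_neg, ← neg_mul] at this
    have key := hc.2 h1' (show t ∈ {s : ℝ | ∀ j, x j + s * d j ∈ Set.Icc (0:ℝ) 1} from h2)
      a1 a2 (by field_simp; ring)
    have e : (t / (s + t)) • (-s) + (s / (s + t)) • t = 0 := by
      simp only [smul_eq_mul]; field_simp; ring
    rw [e] at key
    simpa [sub_eq_add_neg] using key

lemma pgood_nu (n : ℕ) (f : (Fin n → ℝ) → ℝ)
    (hconc1 : ∀ (x : Fin n → ℝ) (a : Fin n),
      ConcaveOn ℝ {s : ℝ | ∀ j, x j + s * ea n a j ∈ Set.Icc (0:ℝ) 1}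
        (fun s => f (fun j => x j + s * ea n a j)))
    (hconc2 : ∀ (x : Fin n → ℝ) (a b : Fin n), a ≠ b →
      ConcaveOn ℝ {s : ℝ | ∀ j, x j + s * dir n a b j ∈ Set.Icc (0:ℝ) 1}
        (fun s => f (fun j => x j + s * dir n a b j)))
    (x : Fin n → ℝ) (hx : ∀ j, x j ∈ Set.Icc (0:ℝ) 1) (ν : (Fin n → ℝ) →₀ ℝ)
    (h : IsPipageNu n x ν) : PGood n f (f x) ν := by
  rcases h with rfl | ⟨a, s, t, h0, h1, hs, hs', ht, ht', rfl⟩ |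
    ⟨a, b, hab, s, t, h0, h1, h2, h3, hs, hs', ht, ht', rfl⟩
  · exact pgood_single n f x hx
  · refine pgood_pair n f x _ s t hs ht (hconc1 x a) ?_ ?_ <;>
    · intro j
      have := (hx j).1
      have := (hx j).2
      unfold ea
      by_cases hj : j = a
      · subst hj; simp only [if_true]; constructor <;> linarith
      · simp only [hj, if_false]; constructor <;> linarith
  · rw [le_min_iff] at hs' ht'
    obtain ⟨_, _⟩ := hs'
    obtain ⟨_, _⟩ := ht'
    refine pgood_pair n f x _ s t hs ht (hconc2 x a b hab) ?_ ?_ <;>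
    · intro j
      have := (hx j).1
      have := (hx j).2
      unfold dir ea
      by_cases hj : j = a
      · subst hj; simp only [hab, if_true, if_false]; constructor <;> linarith
      · by_cases hj' : j = b
        · subst hj'; simp only [hj, if_true, if_false]; constructor <;> linarith
        · simp only [hj, hj', if_false]; constructor <;> linarith

theorem stmt9 (n : ℕ) (f : (Fin n → ℝ) → ℝ)
    (hconc1 : ∀ (x : Fin n → ℝ) (a : Fin n),
      ConcaveOn ℝ {s : ℝ | ∀ j, x j + s * ea n a j ∈ Set.Icc (0:ℝ) 1}
        (fun s => f (fun j => x j + s * ea n a j)))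
    (hconc2 : ∀ (x : Fin n → ℝ) (a b : Fin n), a ≠ b →
      ConcaveOn ℝ {s : ℝ | ∀ j, x j + s * dir n a b j ∈ Set.Icc (0:ℝ) 1}
        (fun s => f (fun j => x j + s * dir n a b j)))
    (xstar : Fin n → ℝ) (hxstar : ∀ j, xstar j ∈ Set.Icc (0:ℝ) 1)
    (p : (Fin n → ℝ) →₀ ℝ)
    (hp : Relation.ReflTransGen (PipageStep n) (Finsupp.single xstar 1) p) :
    p.sum (fun x w => w * f x) ≤ f xstar := by
  have main : PGood n f (f xstar) p := by
    induction hp with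
    | refl => exact pgood_single n f xstar hxstar
    | tail hprev hstep ih =>
      rename_i q r
      obtain ⟨ν, hν, rfl⟩ := hstep
      obtain ⟨i1, i2, i3⟩ := ih
      have g : ∀ x ∈ q.support, PGood n f (f x) (ν x) := fun x hx =>
        pgood_nu n f hconc1 hconc2 x (i2 x (Finsupp.mem_support_iff.1 hx)) _ (hν x hx)
      have ap : ∀ y, (q.sum (fun x w => w • ν x)) y = ∑ x ∈ q.support, q x * ν x y := by
        intro y
        simp [Finsupp.sum, Finsupp.finsetSum_apply]
      refine ⟨fun y => ?_, fun y hy => ?_, ?_⟩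
      · rw [ap]
        exact Finset.sum_nonneg fun x hx => mul_nonneg (i1 x) ((g x hx).1 y)
      · rw [ap] at hy
        obtain ⟨x, hx, hne⟩ := Finset.exists_ne_zero_of_sum_ne_zero hy
        exact (g x hx).2.1 y (right_ne_zero_of_mul hne)
      · refine le_trans ?_ i3
        rw [Finsupp.linearCombination_apply ℝ q]
        simp only [Finsupp.sum, map_sum, map_smul, smul_eq_mul]
        exact Finset.sum_le_sum fun x hx => mul_le_mul_of_nonneg_left (g x hx).2.2 (i1 x)
  have := main.2.2
  rw [Finsupp.linearCombination_apply] at this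
  exact this
end

section
/- Let v be a monotone submodular set function on {1,…,n} with v(∅) = 0 and all marginal values at most 1 (i.e., v(S ∪ {i}) − v(S) ≤ 1 for all S and i). Let x* ∈ [0,1]^n, let μ = F(x*) be the value of the multilinear extension of v at x*, and let p be a finitely supported probability distribution obtained from the point mass at x* by a finite sequence of pipage steps, such that every point in the support of p lies in {0,1}^n. For x ∈ {0,1}^n write U(x) = {i : x_i = 1}. Then for every δ ∈ (0,1), Pr_{x ∼ p}[ v(U(x)) ≤ (1 − δ)·μ ] ≤ exp(−δ²μ/2). -/
/-- The multilinear extension of a set function `v` on ground set `{1,…,n}`: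
`F(x) = ∑_{S ⊆ [n]} v(S) ∏_{j∈S} x_j ∏_{j∉S} (1 - x_j)`. -/
noncomputable def multilinear (n : ℕ) (v : Finset (Fin n) → ℝ) (x : Fin n → ℝ) : ℝ :=
  ∑ S : Finset (Fin n), v S * ((∏ j ∈ S, x j) * ∏ j ∈ Sᶜ, (1 - x j))

noncomputable def wt {n : ℕ} (x : Fin n → ℝ) (S : Finset (Fin n)) : ℝ :=
  (∏ j ∈ S, x j) * ∏ j ∈ Sᶜ, (1 - x j)

lemma wt_nonneg {n : ℕ} {x : Fin n → ℝ} (hx : ∀ j, x j ∈ Set.Icc (0:ℝ) 1)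
    (S : Finset (Fin n)) : 0 ≤ wt x S :=
  mul_nonneg (Finset.prod_nonneg fun j _ => (hx j).1)
    (Finset.prod_nonneg fun j _ => sub_nonneg.2 (hx j).2)

noncomputable def rt {n : ℕ} (a : Fin n) (x : Fin n → ℝ) (S : Finset (Fin n)) : ℝ :=
  (∏ j ∈ S, x j) * ∏ j ∈ (insert a S)ᶜ, (1 - x j)

lemma wt_not_mem {n : ℕ} (x : Fin n → ℝ) (a : Fin n) (T : Finset (Fin n)) (h : a ∉ T) :
    wt x T = (1 - x a) * rt a x T := by
  have : Tᶜ = insert a (insert a T)ᶜ := by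
    ext j; by_cases hj : j = a <;> simp [hj, h]
  unfold wt rt
  rw [this, Finset.prod_insert (by simp)]
  ring

lemma wt_insert {n : ℕ} (x : Fin n → ℝ) (a : Fin n) (T : Finset (Fin n)) (h : a ∉ T) :
    wt x (insert a T) = x a * rt a x T := by
  unfold wt rt
  rw [Finset.prod_insert h]
  ring

lemma rt_update {n : ℕ} (x : Fin n → ℝ) (a : Fin n) (t : ℝ) (T : Finset (Fin n)) (h : a ∉ T) :
    rt a (Function.update x a t) T = rt a x T := by
  unfold rt
  congr 1
  · refine Finset.prod_congr rfl fun j hj => ?_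
    rw [Function.update_of_ne]; rintro rfl; exact h hj
  · refine Finset.prod_congr rfl fun j hj => ?_
    rw [Function.update_of_ne]; rintro rfl; simp at hj

lemma sum_split {n : ℕ} (a : Fin n) (f : Finset (Fin n) → ℝ) :
    ∑ S : Finset (Fin n), f S =
      ∑ T ∈ (Finset.univ.erase a).powerset, (f T + f (insert a T)) := by
  have h := Finset.sum_powerset_insert (Finset.notMem_erase a (Finset.univ : Finset (Fin n))) f
  rw [Finset.insert_erase (Finset.mem_univ a), Finset.powerset_univ] at h
  rw [h, Finset.sum_add_distrib]

lemma ml_eq {n : ℕ} (a : Fin n) (v : Finset (Fin n) → ℝ) (x : Fin n → ℝ) :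
    multilinear n v x = ∑ T ∈ (Finset.univ.erase a).powerset,
      ((1 - x a) * v T + x a * v (insert a T)) * rt a x T := by
  unfold multilinear
  rw [sum_split a]
  refine Finset.sum_congr rfl fun T hT => ?_
  have h : a ∉ T := fun h => by
    have := Finset.mem_powerset.1 hT h
    simp at this
  have h1 := wt_not_mem x a T h
  have h2 := wt_insert x a T h
  unfold wt at h1 h2
  rw [h1, h2]; ring

lemma ml_split {n : ℕ} (a : Fin n) (v : Finset (Fin n) → ℝ) (x : Fin n → ℝ) :
    multilinear n v x = (1 - x a) * multilinear n (fun S => v (S.erase a)) x +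
      x a * multilinear n (fun S => v (insert a S)) x := by
  rw [ml_eq a, ml_eq a (fun S => v (S.erase a)), ml_eq a (fun S => v (insert a S)),
    Finset.mul_sum, Finset.mul_sum, ← Finset.sum_add_distrib]
  refine Finset.sum_congr rfl fun T hT => ?_
  have h : a ∉ T := fun h => by
    have := Finset.mem_powerset.1 hT h
    simp at this
  simp only [Finset.erase_eq_of_notMem h, Finset.erase_insert h, Finset.insert_idem]
  ring

lemma ml_update {n : ℕ} (a : Fin n) (v : Finset (Fin n) → ℝ) (x : Fin n → ℝ) (t : ℝ)
    (hv : ∀ S, a ∉ S → v (insert a S) = v S) :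
    multilinear n v (Function.update x a t) = multilinear n v x := by
  rw [ml_eq a, ml_eq a v x]
  refine Finset.sum_congr rfl fun T hT => ?_
  have h : a ∉ T := fun h => by
    have := Finset.mem_powerset.1 hT h
    simp at this
  rw [rt_update _ _ _ _ h, hv T h]
  ring

lemma ml_mono {n : ℕ} {x : Fin n → ℝ} (hx : ∀ j, x j ∈ Set.Icc (0:ℝ) 1)
    (v w : Finset (Fin n) → ℝ) (h : ∀ S, v S ≤ w S) :
    multilinear n v x ≤ multilinear n w x :=
  Finset.sum_le_sum fun S _ => mul_le_mul_of_nonneg_right (h S) (wt_nonneg hx S)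

lemma ml_add {n : ℕ} (x : Fin n → ℝ) (v w : Finset (Fin n) → ℝ) :
    multilinear n (fun S => v S + w S) x = multilinear n v x + multilinear n w x := by
  unfold multilinear
  rw [← Finset.sum_add_distrib]
  exact Finset.sum_congr rfl fun S _ => by ring

lemma ml_smul {n : ℕ} (x : Fin n → ℝ) (v : Finset (Fin n) → ℝ) (c : ℝ) :
    multilinear n (fun S => c * v S) x = c * multilinear n v x := by
  unfold multilinear
  rw [Finset.mul_sum]
  exact Finset.sum_congr rfl fun S _ => by ring

lemma ml_const {n : ℕ} (x : Fin n → ℝ) (c : ℝ) :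
    multilinear n (fun _ => c) x = c := by
  unfold multilinear
  rw [← Finset.mul_sum]
  have h := Finset.prod_add x (fun j => 1 - x j) (Finset.univ : Finset (Fin n))
  simp only [add_sub_cancel, Finset.prod_const_one, Finset.powerset_univ] at h
  simp only [Finset.compl_eq_univ_sdiff]
  rw [← h, mul_one]

lemma ml_bool {n : ℕ} (x : Fin n → ℝ) (hx : ∀ j, x j = 0 ∨ x j = 1)
    (v : Finset (Fin n) → ℝ) :
    multilinear n v x = v (Finset.univ.filter (fun i : Fin n => x i = 1)) := by
  unfold multilinear
  rw [Finset.sum_eq_single (Finset.univ.filter (fun i : Fin n => x i = 1))]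
  · rw [Finset.prod_eq_one, Finset.prod_eq_one]
    · ring
    · intro j hj
      simp at hj
      rcases hx j with h | h
      · simp [h]
      · exact absurd h hj
    · intro j hj
      simpa using hj
  · intro S _ hS
    by_cases h1 : ∃ j ∈ S, x j = 0
    · obtain ⟨j, hj, h⟩ := h1
      rw [Finset.prod_eq_zero hj h]; ring
    · by_cases h2 : ∃ j ∈ Sᶜ, x j = 1
      · obtain ⟨j, hj, h⟩ := h2
        rw [Finset.prod_eq_zero (i := j) (s := Sᶜ) hj (by rw [h]; ring)]; ring
      · exfalso
        apply hS
        ext j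
        push Not at h1 h2
        simp only [Finset.mem_filter, Finset.mem_univ, true_and]
        constructor
        · intro hj
          exact (hx j).resolve_left (h1 j hj)
        · intro hj
          by_contra h
          exact h2 j (Finset.mem_compl.2 h) hj
  · simp

/-- scalar inequality -/
lemma scalar_ineq (l c t d : ℝ) (hl : 0 ≤ l) (hc : c = 1 - Real.exp (-l))
    (ht0 : 0 ≤ t) (ht1 : t ≤ 1) (hd0 : 0 ≤ d) (hdt : d ≤ t) :
    Real.exp (-l * t + c * (t - d)) ≤ 1 - c * d := by
  have hcl : c ≤ l := by have := Real.add_one_le_exp (-l); linarith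
  have hconv := convexOn_exp.2
  have h1 : Real.exp (-l * t) ≤ 1 - c * t := by
    have := hconv (Set.mem_univ (-l)) (Set.mem_univ 0) ht0 (sub_nonneg.2 ht1) (by ring)
    simp only [smul_eq_mul, mul_zero, add_zero, Real.exp_zero, mul_one] at this
    rw [mul_comm, hc]; linarith
  have h2 : Real.exp (-l * t + c * t) ≤ 1 := by
    rw [Real.exp_le_one_iff]; nlinarith
  rcases eq_or_lt_of_le ht0 with h | h
  · have hd : d = 0 := by linarith
    subst hd; rw [← h]; simp
  · have hs0 : 0 ≤ d / t := by positivity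
    have hs1 : 0 ≤ 1 - d / t := by
      rw [sub_nonneg, div_le_one h]; exact hdt
    have := hconv (Set.mem_univ (-l * t)) (Set.mem_univ (-l * t + c * t)) hs0 hs1 (by ring)
    simp only [smul_eq_mul] at this
    have e : d / t * (-l * t) + (1 - d / t) * (-l * t + c * t) = -l * t + c * (t - d) := by
      field_simp; ring
    rw [e] at this
    have e2 : d / t * (1 - c * t) + (1 - d / t) * 1 = 1 - c * d := by
      field_simp; ring
    have m1 := mul_le_mul_of_nonneg_left h1 hs0
    have m2 := mul_le_mul_of_nonneg_left h2 hs1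
    linarith

lemma indep_bound {n : ℕ} (l c : ℝ) (hl : 0 ≤ l) (hc : c = 1 - Real.exp (-l))
    (x : Fin n → ℝ) (hx : ∀ j, x j ∈ Set.Icc (0:ℝ) 1) (A : Finset (Fin n)) :
    ∀ v : Finset (Fin n) → ℝ, (∀ S T : Finset (Fin n), S ⊆ T → v S ≤ v T) →
    (∀ S T : Finset (Fin n), v S + v T ≥ v (S ∩ T) + v (S ∪ T)) → v ∅ = 0 →
    (∀ (S : Finset (Fin n)) (i : Fin n), v (insert i S) - v S ≤ 1) →
    (∀ S, v S = v (S ∩ A)) →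
    multilinear n (fun S => Real.exp (-l * v S)) x ≤ Real.exp (-c * multilinear n v x) := by
  induction A using Finset.induction_on with
  | empty =>
    intro v _ _ h0 _ hA
    have : v = fun _ => 0 := by
      funext S; rw [hA S]; simpa using h0
    subst this
    rw [ml_const, ml_const]; simp
  | insert a A ha ih =>
    intro v hmono hsub h0 hmarg hA
    have i0 := ih (fun S => v (S.erase a)) (fun S T h => hmono _ _ (Finset.erase_subset_erase a h))
      (fun S T => by
        have := hsub (S.erase a) (T.erase a)
        have e1 : S.erase a ∩ T.erase a = (S ∩ T).erase a := by ext; simp; tauto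
        have e2 : S.erase a ∪ T.erase a = (S ∪ T).erase a := by ext; simp; tauto
        rw [e1, e2] at this; exact this) (by simpa using h0)
      (fun S i => by
        refine le_trans (sub_le_sub_right (hmono _ (insert i (S.erase a)) ?_) _)
          (hmarg (S.erase a) i)
        intro j; simp; tauto)
      (fun S => by
        show v _ = v _
        rw [hA (S.erase a)]
        congr 1
        ext j; simp)
    have i1 := ih (fun S => v (insert a S) - v {a})
      (fun S T h => sub_le_sub_right (hmono _ _ (Finset.insert_subset_insert a h)) _)
      (fun S T => by
        have := hsub (insert a S) (insert a T)
        have e1 : insert a S ∩ insert a T = insert a (S ∩ T) := by ext; simp; tauto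
        have e2 : insert a S ∪ insert a T = insert a (S ∪ T) := by ext; simp
        rw [e1, e2] at this
        show v (insert a S) - v {a} + (v (insert a T) - v {a}) ≥
          v (insert a (S ∩ T)) - v {a} + (v (insert a (S ∪ T)) - v {a})
        linarith) (by simp)
      (fun S i => by
        have := hmarg (insert a S) i
        rw [Finset.insert_comm] at this
        show v (insert a (insert i S)) - v {a} - (v (insert a S) - v {a}) ≤ 1
        linarith)
      (fun S => by
        show v _ - _ = v _ - _
        rw [hA (insert a S), hA (insert a (S ∩ A))]
        congr 2
        ext j; simp; tauto)
    have t0 : 0 ≤ v {a} := h0 ▸ hmono ∅ {a} (by simp)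
    have t1 : v {a} ≤ 1 := by
      have := hmarg ∅ a
      simpa [h0] using this
    set F0 := multilinear n (fun S => v (S.erase a)) x with hF0
    set F1 := multilinear n (fun S => v (insert a S)) x with hF1
    have hF : multilinear n v x = (1 - x a) * F0 + x a * F1 := ml_split a v x
    have hd0 : F0 ≤ F1 := ml_mono hx _ _ fun S => hmono _ _
      ((Finset.erase_subset a S).trans (Finset.subset_insert a S))
    have hdt : F1 ≤ F0 + v {a} := by
      have : F0 + v {a} = multilinear n (fun S => v (S.erase a) + v {a}) x := by
        rw [ml_add x (fun S => v (S.erase a)) (fun _ => v {a}), ml_const]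
      rw [this]
      refine ml_mono hx _ _ fun S => ?_
      have := hsub (S.erase a) {a}
      have e1 : S.erase a ∩ {a} = ∅ := by ext; simp
      have e2 : S.erase a ∪ {a} = insert a S := by ext; simp; tauto
      rw [e1, e2, h0] at this
      linarith
    have e1 : multilinear n (fun S => v (insert a S) - v {a}) x = F1 - v {a} := by
      simp only [sub_eq_add_neg]
      rw [ml_add x (fun S => v (insert a S)) (fun _ => -v {a}), ml_const]
    have e2 : multilinear n (fun S => Real.exp (-l * v (insert a S))) x =
        Real.exp (-l * v {a}) *
          multilinear n (fun S => Real.exp (-l * (v (insert a S) - v {a}))) x := by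
      rw [← ml_smul]
      congr 1
      funext S
      rw [← Real.exp_add]; congr 1; ring
    rw [e1] at i1
    rw [ml_split a, hF, e2]
    have hsc := scalar_ineq l c (v {a}) (F1 - F0) hl hc t0 t1 (by linarith) (by linarith)
    have k1 : Real.exp (-l * v {a}) *
          multilinear n (fun S => Real.exp (-l * (v (insert a S) - v {a}))) x ≤
          Real.exp (-c * F0) * (1 - c * (F1 - F0)) := by
      calc _ ≤ Real.exp (-l * v {a}) * Real.exp (-c * (F1 - v {a})) :=
            mul_le_mul_of_nonneg_left i1 (Real.exp_pos _).le
        _ = Real.exp (-c * F0) * Real.exp (-l * v {a} + c * (v {a} - (F1 - F0))) := by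
            rw [← Real.exp_add, ← Real.exp_add]; congr 1; ring
        _ ≤ _ := mul_le_mul_of_nonneg_left hsc (Real.exp_pos _).le
    have xa0 := (hx a).1
    have xa1 := sub_nonneg.2 (hx a).2
    calc _ ≤ (1 - x a) * Real.exp (-c * F0) +
          x a * (Real.exp (-c * F0) * (1 - c * (F1 - F0))) :=
          add_le_add (mul_le_mul_of_nonneg_left i0 xa1) (mul_le_mul_of_nonneg_left k1 xa0)
      _ = Real.exp (-c * F0) * (-(c * x a * (F1 - F0)) + 1) := by ring
      _ ≤ Real.exp (-c * F0) * Real.exp (-(c * x a * (F1 - F0))) :=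
          mul_le_mul_of_nonneg_left (Real.add_one_le_exp _) (Real.exp_pos _).le
      _ = _ := by rw [← Real.exp_add]; congr 1; ring

lemma ml_two {n : ℕ} (a b : Fin n) (hab : a ≠ b) (w : Finset (Fin n) → ℝ) (x : Fin n → ℝ)
    (t : ℝ) :
    multilinear n w (fun j => x j + t * dir n a b j) =
      (1 - (x a + t)) * ((1 - (x b - t)) * multilinear n (fun S => w ((S.erase b).erase a)) x +
        (x b - t) * multilinear n (fun S => w ((insert b S).erase a)) x) +
      (x a + t) * ((1 - (x b - t)) * multilinear n (fun S => w (insert a (S.erase b))) x +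
        (x b - t) * multilinear n (fun S => w (insert a (insert b S))) x) := by
  have e : (fun j => x j + t * dir n a b j) =
      Function.update (Function.update x a (x a + t)) b (x b - t) := by
    funext j
    unfold dir ea
    by_cases hb : j = b
    · subst hb; simp [hab.symm]; ring
    · by_cases ha : j = a
      · subst ha; simp [hb]
      · simp [ha, hb]
  rw [e, ml_split a, ml_split b (fun S => w (S.erase a)), ml_split b (fun S => w (insert a S))]
  have key : ∀ u : Finset (Fin n) → ℝ, (∀ S, u (insert a S) = u (S.erase a)) →
      (∀ S, u (insert b S) = u (S.erase b)) →
      multilinear n u (Function.update (Function.update x a (x a + t)) b (x b - t)) =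
      multilinear n u x := by
    intro u h1 h2
    rw [ml_update b, ml_update a]
    · intro S hS; rw [h1, Finset.erase_eq_of_notMem hS]
    · intro S hS; rw [h2, Finset.erase_eq_of_notMem hS]
  rw [key, key, key, key]
  · simp [hab]
  all_goals
    intro S
    show w _ = w _
    congr 1
    ext j
    simp only [Finset.mem_insert, Finset.mem_erase]
    grind

lemma ml_one {n : ℕ} (a : Fin n) (w : Finset (Fin n) → ℝ) (x : Fin n → ℝ) (t : ℝ) :
    multilinear n w (fun j => x j + t * ea n a j) =
      (1 - (x a + t)) * multilinear n (fun S => w (S.erase a)) x +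
        (x a + t) * multilinear n (fun S => w (insert a S)) x := by
  have e : (fun j => x j + t * ea n a j) = Function.update x a (x a + t) := by
    funext j
    unfold ea
    by_cases ha : j = a
    · subst ha; simp
    · simp [ha]
  rw [e, ml_split a, ml_update a, ml_update a]
  · simp
  · intro S hS; simp
  · intro S hS; simp [hS]

lemma nu_le {n : ℕ} (w : Finset (Fin n) → ℝ)
    (hw : ∀ S T : Finset (Fin n), w S + w T ≤ w (S ∩ T) + w (S ∪ T))
    (x : Fin n → ℝ) (hx : ∀ j, x j ∈ Set.Icc (0:ℝ) 1) (ν : (Fin n → ℝ) →₀ ℝ)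
    (h : IsPipageNu n x ν) :
    Finsupp.linearCombination ℝ (multilinear n w) ν ≤ multilinear n w x := by
  rcases h with rfl | ⟨a, d1, d2, _, _, h1, _, h2, _, rfl⟩ |
    ⟨a, b, hab, d1, d2, _, _, _, _, h1, _, h2, _, rfl⟩
  · simp
  · simp only [map_add, Finsupp.linearCombination_single, smul_eq_mul]
    have m := ml_one a w x (-d1)
    simp only [neg_mul, ← sub_eq_add_neg] at m
    rw [m, ml_one, ml_split a w x]
    apply le_of_eq
    field_simp
    ring
  · simp only [map_add, Finsupp.linearCombination_single, smul_eq_mul]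
    have m := ml_two a b hab w x (-d1)
    have m0 := ml_two a b hab w x 0
    simp only [neg_mul, ← sub_eq_add_neg, zero_mul, add_zero, sub_zero] at m m0
    rw [m, ml_two a b hab w x d2, m0]
    set A := multilinear n (fun S => w ((S.erase b).erase a)) x with hA
    set B := multilinear n (fun S => w ((insert b S).erase a)) x with hB
    set C := multilinear n (fun S => w (insert a (S.erase b))) x with hC
    set D := multilinear n (fun S => w (insert a (insert b S))) x with hD
    have hk : B + C ≤ A + D := by
      rw [hA, hB, hC, hD, ← ml_add, ← ml_add]
      refine ml_mono hx _ _ fun S => ?_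
      have := hw ((insert b S).erase a) (insert a (S.erase b))
      have e1 : (insert b S).erase a ∩ insert a (S.erase b) = (S.erase b).erase a := by
        ext j; simp only [Finset.mem_insert, Finset.mem_erase, Finset.mem_inter]; grind
      have e2 : (insert b S).erase a ∪ insert a (S.erase b) = insert a (insert b S) := by
        ext j; simp only [Finset.mem_insert, Finset.mem_erase, Finset.mem_union]; grind
      rw [e1, e2] at this
      exact this
    have hp : 0 ≤ d1 * d2 * (A + D - B - C) := mul_nonneg (by positivity) (by linarith)
    rw [← sub_nonneg]
    refine le_of_le_of_eq hp ?_
    field_simp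
    ring

lemma nu_nonneg {n : ℕ} (x : Fin n → ℝ) (ν : (Fin n → ℝ) →₀ ℝ)
    (h : IsPipageNu n x ν) (y : Fin n → ℝ) : 0 ≤ ν y := by
  rcases h with rfl | ⟨a, d1, d2, _, _, h1, _, h2, _, rfl⟩ |
    ⟨a, b, hab, d1, d2, _, _, _, _, h1, _, h2, _, rfl⟩
  · rw [Finsupp.single_apply]; split_ifs <;> norm_num
  all_goals
    rw [Finsupp.add_apply, Finsupp.single_apply, Finsupp.single_apply]
    apply add_nonneg <;> split_ifs <;> positivity

lemma nu_cube {n : ℕ} (x : Fin n → ℝ) (hx : ∀ j, x j ∈ Set.Icc (0:ℝ) 1)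
    (ν : (Fin n → ℝ) →₀ ℝ)
    (h : IsPipageNu n x ν) (y : Fin n → ℝ) (hy : ν y ≠ 0) : ∀ j, y j ∈ Set.Icc (0:ℝ) 1 := by
  rcases h with rfl | ⟨a, d1, d2, g1, g2, h1, h3, h2, h4, rfl⟩ |
    ⟨a, b, hab, d1, d2, g1, g2, g3, g4, h1, h3, h2, h4, rfl⟩
  · rw [Finsupp.single_apply] at hy
    split_ifs at hy with h
    · exact h ▸ hx
    · exact absurd rfl hy
  · rw [Finsupp.add_apply, Finsupp.single_apply, Finsupp.single_apply] at hy
    have : y = (fun j => x j - d1 * ea n a j) ∨ y = (fun j => x j + d2 * ea n a j) := by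
      by_contra hh
      push Not at hh
      rw [if_neg hh.1.symm, if_neg hh.2.symm] at hy
      simp at hy
    intro j
    have := hx j
    rcases ‹_ ∨ _› with rfl | rfl
    all_goals
      by_cases hj : j = a
      · subst hj; simp [ea]; constructor <;> linarith
      · simp [ea, hj]; exact hx j
  · rw [Finsupp.add_apply, Finsupp.single_apply, Finsupp.single_apply] at hy
    have : y = (fun j => x j - d1 * dir n a b j) ∨ y = (fun j => x j + d2 * dir n a b j) := by
      by_contra hh
      push Not at hh
      rw [if_neg hh.1.symm, if_neg hh.2.symm] at hy
      simp at hy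
    rw [le_min_iff] at h3 h4
    intro j
    have := hx j
    rcases ‹_ ∨ _› with rfl | rfl
    all_goals
      by_cases hj : j = a
      · subst hj; simp [dir, ea, hab]; constructor <;> linarith
      · by_cases hb : j = b
        · subst hb; simp [dir, ea, hj]; constructor <;> linarith
        · simp [dir, ea, hj, hb]; exact hx j

lemma pip_inv {n : ℕ} (w : Finset (Fin n) → ℝ)
    (hw : ∀ S T : Finset (Fin n), w S + w T ≤ w (S ∩ T) + w (S ∪ T))
    (x0 : Fin n → ℝ) (hx : ∀ j, x0 j ∈ Set.Icc (0:ℝ) 1) (p : (Fin n → ℝ) →₀ ℝ)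
    (hp : Relation.ReflTransGen (PipageStep n) (Finsupp.single x0 1) p) :
    (∀ y, 0 ≤ p y) ∧ (∀ y, p y ≠ 0 → ∀ j, y j ∈ Set.Icc (0:ℝ) 1) ∧
    Finsupp.linearCombination ℝ (multilinear n w) p ≤ multilinear n w x0 := by
  induction hp with
  | refl =>
    exact ⟨nu_nonneg x0 _ (Or.inl rfl), nu_cube x0 hx _ (Or.inl rfl), by simp⟩
  | tail _ hs ih =>
    obtain ⟨ν, hν, rfl⟩ := hs
    obtain ⟨i1, i2, i3⟩ := ih
    refine ⟨fun y => ?_, fun y hy => ?_, le_trans ?_ i3⟩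
    · rw [Finsupp.sum, Finsupp.finsetSum_apply]
      refine Finset.sum_nonneg fun x hx => ?_
      rw [Finsupp.smul_apply]
      exact mul_nonneg (i1 x) (nu_nonneg x _ (hν x hx) y)
    · rw [Finsupp.sum, Finsupp.finsetSum_apply] at hy
      obtain ⟨x, hx, hxy⟩ := Finset.exists_ne_zero_of_sum_ne_zero hy
      rw [Finsupp.smul_apply] at hxy
      exact nu_cube x (i2 x (Finsupp.mem_support_iff.1 hx)) _ (hν x hx) y
        (right_ne_zero_of_smul hxy)
    · rw [Finsupp.sum, map_sum, Finsupp.linearCombination_apply, Finsupp.sum]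
      refine Finset.sum_le_sum fun x hx => ?_
      rw [map_smul]
      exact mul_le_mul_of_nonneg_left
        (nu_le w hw x (i2 x (Finsupp.mem_support_iff.1 hx)) _ (hν x hx)) (i1 x)

lemma exp_supermod {n : ℕ} (v : Finset (Fin n) → ℝ) (l : ℝ) (hl : 0 ≤ l)
    (hmono : ∀ S T : Finset (Fin n), S ⊆ T → v S ≤ v T)
    (hsub : ∀ S T : Finset (Fin n), v S + v T ≥ v (S ∩ T) + v (S ∪ T))
    (S T : Finset (Fin n)) :
    Real.exp (-l * v S) + Real.exp (-l * v T) ≤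
      Real.exp (-l * v (S ∩ T)) + Real.exp (-l * v (S ∪ T)) := by
  set m := v (S ∩ T)
  have hS : m ≤ v S := hmono _ _ Finset.inter_subset_left
  have hT : m ≤ v T := hmono _ _ Finset.inter_subset_right
  have h := hsub S T
  have e1 : Real.exp (-l * v S) = Real.exp (-l * m) * Real.exp (-l * (v S - m)) := by
    rw [← Real.exp_add]; congr 1; ring
  have e2 : Real.exp (-l * v T) = Real.exp (-l * m) * Real.exp (-l * (v T - m)) := by
    rw [← Real.exp_add]; congr 1; ring
  have e3 : Real.exp (-l * m) * (Real.exp (-l * (v S - m)) * Real.exp (-l * (v T - m))) ≤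
      Real.exp (-l * v (S ∪ T)) := by
    rw [← Real.exp_add, ← Real.exp_add]
    apply Real.exp_le_exp.2
    nlinarith
  have a1 : Real.exp (-l * (v S - m)) ≤ 1 := Real.exp_le_one_iff.2 (by nlinarith)
  have a2 : Real.exp (-l * (v T - m)) ≤ 1 := Real.exp_le_one_iff.2 (by nlinarith)
  have := mul_nonneg (Real.exp_pos (-l * m)).le (mul_nonneg (sub_nonneg.2 a1) (sub_nonneg.2 a2))
  rw [e1, e2]
  linarith

lemma log_ineq (δ : ℝ) (h0 : 0 < δ) (h1 : δ < 1) :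
    -Real.log (1 - δ) * (1 - δ) - δ ≤ -δ ^ 2 / 2 := by
  have hy : 0 < 1 - δ := by linarith
  have hs : 0 ≤ -Real.log (1 - δ) := neg_nonneg.2 (Real.log_nonpos hy.le (by linarith))
  have := Real.self_le_sinh_iff.2 hs
  rw [Real.sinh_eq, neg_neg, Real.exp_neg, Real.exp_log hy] at this
  have h2 := mul_le_mul_of_nonneg_right this hy.le
  have e : ((1 - δ)⁻¹ - (1 - δ)) / 2 * (1 - δ) = (1 - (1 - δ) ^ 2) / 2 := by
    field_simp
  rw [e] at h2
  linarith

theorem stmt10 (n : ℕ) (v : Finset (Fin n) → ℝ)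
    (hmono : ∀ S T : Finset (Fin n), S ⊆ T → v S ≤ v T)
    (hsub : ∀ S T : Finset (Fin n), v S + v T ≥ v (S ∩ T) + v (S ∪ T))
    (h0 : v ∅ = 0)
    (hmarg : ∀ (S : Finset (Fin n)) (i : Fin n), v (insert i S) - v S ≤ 1)
    (xstar : Fin n → ℝ) (hxstar : ∀ j, xstar j ∈ Set.Icc (0:ℝ) 1)
    (μ : ℝ) (hμ : μ = multilinear n v xstar)
    (p : (Fin n → ℝ) →₀ ℝ)
    (hp : Relation.ReflTransGen (PipageStep n) (Finsupp.single xstar 1) p)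
    (hbool : ∀ x ∈ p.support, ∀ j : Fin n, x j = 0 ∨ x j = 1)
    (δ : ℝ) (hδ : δ ∈ Set.Ioo (0:ℝ) 1) :
    p.sum (fun x w =>
        if v (Finset.univ.filter (fun i : Fin n => x i = 1)) ≤ (1 - δ) * μ then w else 0) ≤
      Real.exp (-δ ^ 2 * μ / 2) := by
  obtain ⟨hδ0, hδ1⟩ := hδ
  have hy : 0 < 1 - δ := by linarith
  set l := -Real.log (1 - δ) with hl'
  have hl : 0 ≤ l := neg_nonneg.2 (Real.log_nonpos hy.le (by linarith))
  have hc : δ = 1 - Real.exp (-l) := by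
    rw [hl', neg_neg, Real.exp_log hy]; ring
  obtain ⟨i1, _, i3⟩ := pip_inv (fun S => Real.exp (-l * v S))
    (exp_supermod v l hl hmono hsub) xstar hxstar p hp
  have hb := indep_bound l δ hl hc xstar hxstar Finset.univ v hmono hsub h0 hmarg
    (fun S => by simp)
  rw [← hμ] at hb
  have hμ0 : 0 ≤ μ := by
    have := ml_mono hxstar (fun _ => 0) v (fun S => h0 ▸ hmono ∅ S (by simp))
    rw [ml_const] at this
    rw [hμ]; exact this
  have key : p.sum (fun x w =>
        if v (Finset.univ.filter (fun i : Fin n => x i = 1)) ≤ (1 - δ) * μ then w else 0) ≤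
      Real.exp (l * ((1 - δ) * μ)) *
        Finsupp.linearCombination ℝ (multilinear n (fun S => Real.exp (-l * v S))) p := by
    rw [Finsupp.linearCombination_apply, Finsupp.sum, Finsupp.sum, Finset.mul_sum]
    refine Finset.sum_le_sum fun x hx => ?_
    rw [ml_bool x (hbool x hx), smul_eq_mul, mul_left_comm, ← Real.exp_add]
    split_ifs with h
    · refine le_mul_of_one_le_right (i1 x) (Real.one_le_exp ?_)
      nlinarith
    · exact mul_nonneg (i1 x) (Real.exp_pos _).le
  refine key.trans ((mul_le_mul_of_nonneg_left (i3.trans hb) (Real.exp_pos _).le).trans ?_)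
  rw [← Real.exp_add]
  apply Real.exp_le_exp.2
  have := mul_le_mul_of_nonneg_right (log_ineq δ hδ0 hδ1) hμ0
  rw [← hl'] at this
  linarith
end
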